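/- Let (L, B) be a unimodular lattice, let N ≤ L be a primitive subgroup, and let T = N^⊥. Then the homomorphism L ⊗_ℤ (ℚ/ℤ) → Hom(T, ℚ/ℤ), determined on simple tensors by v ⊗ q ↦ (t ↦ B(v, t)·q), is surjective, and its kernel is the image of N ⊗_ℤ (ℚ/ℤ) in L ⊗_ℤ (ℚ/ℤ); consequently it induces an isomorphism (L/N) ⊗_ℤ (ℚ/ℤ) ≅ Hom(T, ℚ/ℤ). -/

import Mathlib

/-- The orthogonal complement `N^⊥ = {v ∈ L | B(v, x) = 0 for all x ∈ N}` of a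
subgroup `N` of a lattice `(L, B)`. -/
def orthComplement {L : Type*} [AddCommGroup L]
    (B : L →ₗ[ℤ] L →ₗ[ℤ] ℤ) (N : Submodule ℤ L) : Submodule ℤ L where
  carrier := {v | ∀ x ∈ N, B v x = 0}
  add_mem' := by
    intro a b ha hb x hx
    simp [ha x hx, hb x hx]
  zero_mem' := by
    intro x hx
    simp
  smul_mem' := by
    intro c a ha x hx
    simp [ha x hx]

/-- The homomorphism `N^⊥ →ₗ ℚ/ℤ` given by `t ↦ B v t • q`. -/
def pairSmul {L : Type*} [AddCommGroup L]
    (B : L →ₗ[ℤ] L →ₗ[ℤ] ℤ) (N : Submodule ℤ L)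
    (v : L) (q : AddCircle (1 : ℚ)) :
    ↥(orthComplement B N) →ₗ[ℤ] AddCircle (1 : ℚ) where
  toFun t := B v (t : L) • q
  map_add' a b := by simp [add_smul]
  map_smul' c a := by simp [mul_smul]

/-- The natural bilinear map `L × ℚ/ℤ → Hom(N^⊥, ℚ/ℤ)`,
`(v, q) ↦ (t ↦ B v t • q)`. -/
def pairSmulBil {L : Type*} [AddCommGroup L]
    (B : L →ₗ[ℤ] L →ₗ[ℤ] ℤ) (N : Submodule ℤ L) :
    L →ₗ[ℤ] AddCircle (1 : ℚ) →ₗ[ℤ]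
      (↥(orthComplement B N) →ₗ[ℤ] AddCircle (1 : ℚ)) :=
  LinearMap.mk₂ ℤ (pairSmul B N)
    (fun v w q => by ext t; simp [pairSmul, add_smul])
    (fun c v q => by ext t; simp [pairSmul, mul_smul])
    (fun v q r => by ext t; simp [pairSmul])
    (fun c v q => by ext t; simp [pairSmul, smul_comm c])

/-- The pairing `L / N → Hom(N^⊥, ℤ)` induced by `B`. -/
noncomputable def quotientToDualOrth {L : Type*} [AddCommGroup L]
    (B : L →ₗ[ℤ] L →ₗ[ℤ] ℤ) (hsymm : ∀ x y : L, B x y = B y x) (N : Submodule ℤ L) :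
    (L ⧸ N) →ₗ[ℤ] Module.Dual ℤ (orthComplement B N) :=
  N.liftQ ((orthComplement B N).subtype.dualMap ∘ₗ B) fun v hv => by
    ext t
    exact (hsymm v t).trans (t.2 v hv)

/-- The pairing `N^⊥ → Hom(L / N, ℤ)` induced by `B`. -/
noncomputable def orthToDualQuotient {L : Type*} [AddCommGroup L]
    (B : L →ₗ[ℤ] L →ₗ[ℤ] ℤ) (hsymm : ∀ x y : L, B x y = B y x) (N : Submodule ℤ L) :
    orthComplement B N →ₗ[ℤ] Module.Dual ℤ (L ⧸ N) :=
  (quotientToDualOrth B hsymm N).flip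

theorem orthToDualQuotient_mk {L : Type*} [AddCommGroup L]
    (B : L →ₗ[ℤ] L →ₗ[ℤ] ℤ) (hsymm : ∀ x y : L, B x y = B y x) (N : Submodule ℤ L)
    (t : orthComplement B N) (v : L) :
    orthToDualQuotient B hsymm N t (N.mkQ v) = B v t := rfl

theorem bijective_orthToDualQuotient {L : Type*} [AddCommGroup L]
    (B : L →ₗ[ℤ] L →ₗ[ℤ] ℤ) (hsymm : ∀ x y : L, B x y = B y x)
    (hunim : Function.Bijective fun v : L => B v) (N : Submodule ℤ L) :
    Function.Bijective (orthToDualQuotient B hsymm N) := by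
  constructor
  · intro s t hst
    refine Subtype.ext (hunim.1 (LinearMap.ext fun v => ?_))
    have h := LinearMap.congr_fun hst (N.mkQ v)
    rw [orthToDualQuotient_mk, orthToDualQuotient_mk] at h
    rw [hsymm s v, hsymm t v, h]
  · intro f
    obtain ⟨t, ht⟩ := hunim.2 (f ∘ₗ N.mkQ)
    have hB (v : L) : B t v = f (N.mkQ v) := LinearMap.congr_fun ht v
    refine ⟨⟨t, fun x hx => ?_⟩, LinearMap.ext fun w => ?_⟩
    · rw [hB, N.mkQ_apply, (Submodule.Quotient.mk_eq_zero N).2 hx, map_zero]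
    · obtain ⟨v, rfl⟩ := N.mkQ_surjective w
      rw [orthToDualQuotient_mk, hsymm, hB]

theorem bijective_quotientToDualOrth {L : Type*} [AddCommGroup L] [Module.Finite ℤ L]
    (B : L →ₗ[ℤ] L →ₗ[ℤ] ℤ) (hsymm : ∀ x y : L, B x y = B y x)
    (hunim : Function.Bijective fun v : L => B v) (N : Submodule ℤ L)
    [Module.Free ℤ (L ⧸ N)] :
    Function.Bijective (quotientToDualOrth B hsymm N) := by
  let e := LinearEquiv.ofBijective _ (bijective_orthToDualQuotient B hsymm hunim N)
  exact ((Module.evalEquiv ℤ (L ⧸ N)).trans e.dualMap).bijective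

theorem free_quotient_of_primitive {L : Type*} [AddCommGroup L] [Module.Finite ℤ L]
    (N : Submodule ℤ L) (hprim : ∀ (n : ℤ) (x : L), n ≠ 0 → n • x ∈ N → x ∈ N) :
    Module.Free ℤ (L ⧸ N) := by
  have : Module.IsTorsionFree ℤ (L ⧸ N) := by
    refine .of_smul_eq_zero fun n w h => ?_
    obtain ⟨v, rfl⟩ := N.mkQ_surjective w
    rw [← map_smul, N.mkQ_apply, Submodule.Quotient.mk_eq_zero] at h
    rw [N.mkQ_apply, Submodule.Quotient.mk_eq_zero]
    exact or_iff_not_imp_left.2 fun hn => hprim n v hn h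
  infer_instance

/-- For a unimodular lattice `(L, B)` with primitive subgroup `N` and `T = N^⊥`,
the map `L ⊗ ℚ/ℤ → Hom(T, ℚ/ℤ)`, `v ⊗ q ↦ (t ↦ B v t • q)`, is surjective with
kernel the image of `N ⊗ ℚ/ℤ` in `L ⊗ ℚ/ℤ`, inducing an isomorphism
`(L/N) ⊗ ℚ/ℤ ≅ Hom(T, ℚ/ℤ)`. -/
theorem tensor_QZ_pairing_of_unimodular
    (L : Type*) [AddCommGroup L]
    [Module.Free ℤ L] [Module.Finite ℤ L]
    (B : L →ₗ[ℤ] L →ₗ[ℤ] ℤ)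
    (hsymm : ∀ x y : L, B x y = B y x)
    (hunim : Function.Bijective fun v : L => B v)
    (N : Submodule ℤ L)
    (hprim : ∀ (n : ℤ) (x : L), n ≠ 0 → n • x ∈ N → x ∈ N) :
    Function.Surjective (TensorProduct.lift (pairSmulBil B N)) ∧
      LinearMap.ker (TensorProduct.lift (pairSmulBil B N)) =
        LinearMap.range
          (TensorProduct.map N.subtype
            (LinearMap.id (R := ℤ) (M := AddCircle (1 : ℚ)))) ∧
      Nonempty
        ((TensorProduct ℤ (L ⧸ N) (AddCircle (1 : ℚ))) ≃ₗ[ℤ]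
          (↥(orthComplement B N) →ₗ[ℤ] AddCircle (1 : ℚ))) := by
  have := free_quotient_of_primitive N hprim
  let e := LinearEquiv.ofBijective _ (bijective_quotientToDualOrth B hsymm hunim N)
  let ψ := (e.rTensor (AddCircle (1 : ℚ))).trans
    (dualTensorHomEquiv ℤ (orthComplement B N) (AddCircle (1 : ℚ)))
  have hψ : TensorProduct.lift (pairSmulBil B N) =
      ψ.toLinearMap ∘ₗ N.mkQ.rTensor (AddCircle (1 : ℚ)) := by
    refine TensorProduct.ext' fun v q => LinearMap.ext fun t => ?_
    simp [ψ, e, pairSmulBil, pairSmul]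
    rfl
  refine ⟨?_, ?_, ⟨ψ⟩⟩
  · rw [hψ]
    exact ψ.surjective.comp (LinearMap.rTensor_surjective _ N.mkQ_surjective)
  · rw [hψ, LinearEquiv.ker_comp]
    exact LinearMap.exact_iff.1 (rTensor_exact (AddCircle (1 : ℚ))
      (LinearMap.exact_subtype_mkQ N) N.mkQ_surjective)
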